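/- (Uniqueness for the direct semilinear problem, Dirichlet case) Let β ∈ (0,1), Ω ⊂ ℝ^n bounded open with smooth boundary, A elliptic with a_{ij}, a_j ∈ C(Ω̄), and f ∈ C(ℝ×[0,T]×Ω̄). Suppose u^1 and u^2 both solve D^β[u − u_0] = Au + f(u,t,x) on (0,T)×Ω with u(0,·) = u_0 on Ω and u = g on (0,T)×∂Ω (same u_0 and g), where u^l ∈ C^{β'}([0,T];C(Ω̄)) for some β' > β and u^l_{x_j}, u^l_{x_i x_j} ∈ C((0,T]×Ω̄) for l = 1,2. If there is M > 0 such that |f(u^1(t,x),t,x) − f(u^2(t,x),t,x)| ≤ M|u^1(t,x) − u^2(t,x)| for all t ∈ [0,T], x ∈ Ω̄, then u^1 = u^2. -/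

import Mathlib

open Set MeasureTheory Filter Topology

/-- The convolution `t ↦ ∫_0^t k(t-τ) w(τ) dτ`. -/
noncomputable def kConv (k w : ℝ → ℝ) (t : ℝ) : ℝ := ∫ τ in (0:ℝ)..t, k (t - τ) * w τ

/-- The generalized fractional derivative `D^{{k}} w = (d/dt) ∫_0^t k(t-τ) w(τ) dτ`
(derivative within `[0,T]`, i.e. one-sided at the endpoints). -/
noncomputable def Dk (k : ℝ → ℝ) (T : ℝ) (w : ℝ → ℝ) (t : ℝ) : ℝ :=
  derivWithin (kConv k w) (Icc 0 T) t

/-- The kernel assumptions: `k ∈ L¹(0,T) ∩ C(0,T]`, `k > 0`, `k` decreasing. -/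
def KernelOK (k : ℝ → ℝ) (T : ℝ) : Prop :=
  IntegrableOn k (Ioc 0 T) ∧ ContinuousOn k (Ioc 0 T) ∧ (∀ t ∈ Ioc 0 T, 0 < k t) ∧
    ∀ s ∈ Ioc (0:ℝ) T, ∀ t ∈ Ioc (0:ℝ) T, s ≤ t → k t ≤ k s

/-- Partial derivative `∂v/∂x_i`. -/
noncomputable def pd {n : ℕ} (i : Fin n) (v : (Fin n → ℝ) → ℝ) (x : Fin n → ℝ) : ℝ :=
  fderiv ℝ v x (Pi.single i 1)

/-- The second order operator
`A(x)v = Σ_{i,j} a_{ij}(x) ∂²v/∂x_i∂x_j + Σ_j a_j(x) ∂v/∂x_j`. -/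
noncomputable def ellOp {n : ℕ} (aC : Fin n → Fin n → (Fin n → ℝ) → ℝ)
    (bC : Fin n → (Fin n → ℝ) → ℝ) (v : (Fin n → ℝ) → ℝ) (x : Fin n → ℝ) : ℝ :=
  (∑ i, ∑ j, aC i j x * pd i (pd j v) x) + ∑ j, bC j x * pd j v x

/-- Uniform ellipticity: `Σ_{i,j} a_{ij}(x) ξ_i ξ_j ≥ c |ξ|²` on `Ω`. -/
def IsElliptic {n : ℕ} (aC : Fin n → Fin n → (Fin n → ℝ) → ℝ) (Ω : Set (Fin n → ℝ)) : Prop :=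
  ∃ c > 0, ∀ x ∈ Ω, ∀ ξ : Fin n → ℝ, c * ∑ i, ξ i ^ 2 ≤ ∑ i, ∑ j, aC i j x * ξ i * ξ j

/-- Condition (as4): for every `t ∈ (0,T]`, `x ∈ Ω̄`,
`(1/ε) ∫_0^ε k(τ)dτ · sup_{0≤s≤ε} |u(t-s,x) - u(t,x)| → 0` as `ε → 0⁺`. -/
def As4 {n : ℕ} (k : ℝ → ℝ) (T : ℝ) (Ω : Set (Fin n → ℝ)) (u : ℝ → (Fin n → ℝ) → ℝ) : Prop :=
  ∀ t ∈ Ioc (0:ℝ) T, ∀ x ∈ closure Ω,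
    Tendsto (fun ε => ε⁻¹ * (∫ τ in (0:ℝ)..ε, k τ) *
        sSup ((fun s => |u (t - s) x - u t x|) '' Icc 0 ε)) (𝓝[>] 0) (𝓝 0)

/-- Riemann–Liouville fractional derivative of order `β` (derivative within `[0,T]`). -/
noncomputable def RLD (β T : ℝ) (w : ℝ → ℝ) (t : ℝ) : ℝ :=
  derivWithin (fun s => (Real.Gamma (1 - β))⁻¹ * ∫ τ in (0:ℝ)..s, (s - τ) ^ (-β) * w τ)
    (Icc 0 T) t


open scoped ComplexOrder MatrixOrder in
lemma psd_exists_sq {n : ℕ} (H : Matrix (Fin n) (Fin n) ℝ) (hH : H.PosSemidef) :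
    ∃ B : Matrix (Fin n) (Fin n) ℝ, H = B.transpose * B := by
  obtain ⟨B, hB⟩ := CStarAlgebra.nonneg_iff_eq_star_mul_self.mp hH.nonneg
  refine ⟨B, ?_⟩
  rw [hB, Matrix.star_eq_conjTranspose, Matrix.conjTranspose_eq_transpose_of_trivial]

lemma trace_nonpos {n : ℕ} (a H : Fin n → Fin n → ℝ)
    (ha : ∀ ξ : Fin n → ℝ, 0 ≤ ∑ i, ∑ j, a i j * ξ i * ξ j)
    (hs : ∀ i j, H i j = H j i)
    (hH : ∀ ξ : Fin n → ℝ, ∑ i, ∑ j, H i j * ξ i * ξ j ≤ 0) :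
    ∑ i, ∑ j, a i j * H i j ≤ 0 := by
  have hp : (Matrix.of (fun i j => - H i j)).PosSemidef := by
    refine .of_dotProduct_mulVec_nonneg ?_ ?_
    · ext i j
      simp [hs i j]
    · intro x
      have := hH x
      simp only [dotProduct, Matrix.mulVec, Matrix.of_apply, Finset.mul_sum, star_trivial]
      have e : ∑ i, ∑ j, x i * (-H i j * x j) = - ∑ i, ∑ j, H i j * x i * x j := by
        rw [← Finset.sum_neg_distrib]
        refine Finset.sum_congr rfl fun i _ => ?_
        rw [← Finset.sum_neg_distrib]
        refine Finset.sum_congr rfl fun j _ => ?_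
        ring
      rw [e]; linarith
  obtain ⟨B, hB⟩ := psd_exists_sq _ hp
  have hB' : ∀ i j, H i j = - ∑ k, B k i * B k j := by
    intro i j
    have := congrFun (congrFun hB i) j
    simp only [Matrix.of_apply, Matrix.mul_apply, Matrix.transpose_apply] at this
    linarith
  have e : ∑ i, ∑ j, a i j * H i j = - ∑ k, ∑ i, ∑ j, a i j * B k i * B k j := by
    have e1 : ∑ k, ∑ i, ∑ j, a i j * B k i * B k j
        = ∑ i, ∑ j, ∑ k, a i j * B k i * B k j := by
      rw [Finset.sum_comm]
      refine Finset.sum_congr rfl fun i _ => ?_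
      rw [Finset.sum_comm]
    rw [e1, ← Finset.sum_neg_distrib]
    refine Finset.sum_congr rfl fun i _ => ?_
    rw [← Finset.sum_neg_distrib]
    refine Finset.sum_congr rfl fun j _ => ?_
    rw [hB', mul_neg, Finset.mul_sum]
    congr 1
    refine Finset.sum_congr rfl fun k _ => ?_
    ring
  rw [e]
  have : 0 ≤ ∑ k, ∑ i, ∑ j, a i j * B k i * B k j :=
    Finset.sum_nonneg fun k _ => ha (B k)
  linarith

lemma second_deriv_nonpos (g : ℝ → ℝ) (hm : IsLocalMax g 0) (hc : ContinuousAt g 0) :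
    deriv (deriv g) 0 ≤ 0 := by
  by_contra h
  push Not at h
  have hmin := isLocalMin_of_deriv_deriv_pos h hm.deriv_eq_zero hc
  have hconst : g =ᶠ[𝓝 0] fun _ => g 0 := by
    filter_upwards [hm, hmin] with x h1 h2 using le_antisymm h1 h2
  have h1 : deriv g =ᶠ[𝓝 0] fun _ => 0 := by
    have := hconst.deriv
    simpa using this
  have := h1.deriv_eq
  simp at this
  linarith

lemma ellOp_nonpos {n : ℕ} (aC : Fin n → Fin n → (Fin n → ℝ) → ℝ)
    (bC : Fin n → (Fin n → ℝ) → ℝ) (v : (Fin n → ℝ) → ℝ) (x : Fin n → ℝ)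
    (ha : ∀ ξ : Fin n → ℝ, 0 ≤ ∑ i, ∑ j, aC i j x * ξ i * ξ j)
    (hv : ∀ᶠ y in 𝓝 x, DifferentiableAt ℝ v y)
    (hv2 : ∀ j, DifferentiableAt ℝ (pd j v) x)
    (hm : IsLocalMax v x) : ellOp aC bC v x ≤ 0 := by
  have hgrad : ∀ j, pd j v x = 0 := by
    intro j
    simp [pd, hm.fderiv_eq_zero]
  have hexp : ∀ (L : (Fin n → ℝ) →L[ℝ] ℝ) (ξ : Fin n → ℝ),
      L ξ = ∑ j, ξ j * L (Pi.single j 1) := by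
    intro L ξ
    conv_lhs => rw [pi_eq_sum_univ' ξ]
    simp [map_sum, smul_eq_mul]
  have hsum : ∀ y ξ, fderiv ℝ v y ξ = ∑ j, ξ j * pd j v y := fun y ξ => hexp _ ξ
  -- the derivative is differentiable
  have hfd : DifferentiableAt ℝ (fderiv ℝ v) x := by
    have e : fderiv ℝ v = fun y => ∑ j, (pd j v y) •
        (ContinuousLinearMap.proj (R := ℝ) (φ := fun _ : Fin n => ℝ) j) := by
      funext y
      ext ξ
      simp only [hsum, _root_.sum_apply, _root_.smul_apply,
        ContinuousLinearMap.proj_apply, smul_eq_mul]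
      exact Finset.sum_congr rfl fun j _ => mul_comm _ _
    rw [e]
    refine DifferentiableAt.fun_sum fun j _ => ?_
    exact (hv2 j).smul_const _
  set S := fderiv ℝ (fderiv ℝ v) x with hS
  have hSd : HasFDerivAt (fderiv ℝ v) S x := hfd.hasFDerivAt
  have hsymm : ∀ a b, S a b = S b a :=
    second_derivative_symmetric_of_eventually (hv.mono fun y hy => hy.hasFDerivAt) hSd
  have hH : ∀ i j, pd i (pd j v) x = S (Pi.single i 1) (Pi.single j 1) := by
    intro i j
    have : HasFDerivAt (pd j v) (S.flip (Pi.single j 1)) x := by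
      have := hSd.clm_apply (hasFDerivAt_const (Pi.single j (1:ℝ)) x)
      refine this.congr_fderiv ?_
      ext; simp
    rw [pd, this.fderiv]
    simp
  have hneg : ∀ ξ, S ξ ξ ≤ 0 := by
    intro ξ
    let ℓ : ℝ → (Fin n → ℝ) := fun s => x + s • ξ
    have hℓ : ∀ s, HasDerivAt ℓ ξ s := by
      intro s
      have := ((hasDerivAt_id s).smul_const ξ).const_add x
      simpa [ℓ] using this
    have hℓ0 : ℓ 0 = x := by simp [ℓ]
    have hℓc : Tendsto ℓ (𝓝 0) (𝓝 x) := by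
      have := (hℓ 0).continuousAt.tendsto
      rwa [hℓ0] at this
    have hder : deriv (fun s => v (ℓ s)) =ᶠ[𝓝 0] fun s => fderiv ℝ v (ℓ s) ξ := by
      filter_upwards [hℓc.eventually hv] with s hs
      exact (hs.hasFDerivAt.comp_hasDerivAt s (hℓ s)).deriv
    have h2 : deriv (deriv (fun s => v (ℓ s))) 0 = S ξ ξ := by
      rw [hder.deriv_eq]
      have h3 : HasDerivAt (fun s => fderiv ℝ v (ℓ s)) (S ξ) 0 := by
        have := hSd
        rw [← hℓ0] at this
        exact this.comp_hasDerivAt 0 (hℓ 0)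
      have h4 := h3.clm_apply (hasDerivAt_const 0 ξ)
      simpa using h4.deriv
    rw [← h2]
    apply second_deriv_nonpos
    · have := hℓc.eventually hm
      simpa [IsLocalMax, IsMaxFilter, hℓ0] using this
    · have h5 : ContinuousAt v (ℓ 0) := by rw [hℓ0]; exact hv.self_of_nhds.continuousAt
      exact h5.comp (hℓ 0).continuousAt
  have := trace_nonpos (fun i j => aC i j x) (fun i j => pd i (pd j v) x) ha
    (by intro i j; rw [hH, hH, hsymm])
    (by
      intro ξ
      have h6 : S ξ ξ = ∑ i, ∑ j, pd i (pd j v) x * ξ i * ξ j := by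
        rw [hexp (S ξ) ξ, Finset.sum_comm]
        refine Finset.sum_congr rfl fun j _ => ?_
        rw [← ContinuousLinearMap.flip_apply, hexp (S.flip _) ξ, Finset.mul_sum]
        refine Finset.sum_congr rfl fun i _ => ?_
        rw [hH, ContinuousLinearMap.flip_apply]; ring
      rw [← h6]; exact hneg ξ)
  simpa [ellOp, hgrad] using this

lemma ellOp_sub {n : ℕ} (aC : Fin n → Fin n → (Fin n → ℝ) → ℝ)
    (bC : Fin n → (Fin n → ℝ) → ℝ) (v w : (Fin n → ℝ) → ℝ) (x : Fin n → ℝ)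
    (hv : ∀ᶠ y in 𝓝 x, DifferentiableAt ℝ v y)
    (hv2 : ∀ j, DifferentiableAt ℝ (pd j v) x)
    (hw : ∀ᶠ y in 𝓝 x, DifferentiableAt ℝ w y)
    (hw2 : ∀ j, DifferentiableAt ℝ (pd j w) x) :
    (∀ j, DifferentiableAt ℝ (pd j (fun y => v y - w y)) x) ∧
    ellOp aC bC (fun y => v y - w y) x = ellOp aC bC v x - ellOp aC bC w x := by
  have h1 : ∀ j, pd j (fun y => v y - w y) =ᶠ[𝓝 x] fun y => pd j v y - pd j w y := by
    intro j
    filter_upwards [hv, hw] with y h1 h2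
    simp [pd, fderiv_fun_sub h1 h2]
  refine ⟨fun j => ((hv2 j).sub (hw2 j)).congr_of_eventuallyEq (h1 j), ?_⟩
  have h2 : ∀ i j, pd i (pd j (fun y => v y - w y)) x = pd i (pd j v) x - pd i (pd j w) x := by
    intro i j
    rw [pd, (h1 j).fderiv_eq, fderiv_fun_sub (hv2 j) (hw2 j)]
    simp [pd]
  simp only [ellOp, h2, fun j => (h1 j).self_of_nhds, mul_sub, Finset.sum_sub_distrib]
  ring

/-- The truncated power `s_+^r` (with value `0` for `s ≤ 0`, when `r ≠ 0`). -/
noncomputable def posPow (r s : ℝ) : ℝ := (max s 0) ^ r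

lemma posPow_nonneg (r s : ℝ) : 0 ≤ posPow r s := Real.rpow_nonneg (le_max_right _ _) _

lemma posPow_of_nonpos {r s : ℝ} (hr : r ≠ 0) (hs : s ≤ 0) : posPow r s = 0 := by
  rw [posPow, max_eq_right hs, Real.zero_rpow hr]

lemma posPow_of_nonneg {r s : ℝ} (hs : 0 ≤ s) : posPow r s = s ^ r := by
  rw [posPow, max_eq_left hs]

lemma posPow_measurable (r : ℝ) : Measurable (posPow r) := by
  unfold posPow
  fun_prop

lemma posPow_intervalIntegrable {r : ℝ} (hr0 : r ≠ 0) (hr : -1 < r) (a b : ℝ) :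
    IntervalIntegrable (posPow r) volume a b := by
  refine (intervalIntegral.intervalIntegrable_rpow' hr (a := a) (b := b)).mono_fun
    (posPow_measurable r).aestronglyMeasurable (Eventually.of_forall fun s => ?_)
  show ‖posPow r s‖ ≤ ‖s ^ r‖
  rcases le_total s 0 with h | h
  · rw [posPow_of_nonpos hr0 h]; simp
  · rw [posPow_of_nonneg h]

lemma posPow_integral {r : ℝ} (hr0 : r ≠ 0) (hr : -1 < r) {R : ℝ} (hR : 0 ≤ R) :
    ∫ s in (-R)..R, posPow r s = R ^ (r + 1) / (r + 1) := by
  rw [← intervalIntegral.integral_add_adjacent_intervals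
    (posPow_intervalIntegrable hr0 hr (-R) 0) (posPow_intervalIntegrable hr0 hr 0 R)]
  have h1 : ∫ s in (-R)..0, posPow r s = 0 := by
    rw [intervalIntegral.integral_congr (g := fun _ => (0:ℝ))]
    · simp
    · intro s hs
      rw [uIcc_of_le (by linarith)] at hs
      exact posPow_of_nonpos hr0 hs.2
  have h2 : ∫ s in (0:ℝ)..R, posPow r s = ∫ s in (0:ℝ)..R, s ^ r := by
    apply intervalIntegral.integral_congr
    intro s hs
    rw [uIcc_of_le hR] at hs
    exact posPow_of_nonneg hs.1
  rw [h1, h2, integral_rpow (Or.inl hr), Real.zero_rpow (by linarith)]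
  simp

lemma posPow_shift_integrable {r : ℝ} (hr0 : r ≠ 0) (hr : -1 < r) (h R : ℝ) (hR : 0 ≤ R) :
    IntegrableOn (fun s => posPow r (s + h)) (Icc (-R) R) := by
  have := (posPow_intervalIntegrable hr0 hr (-R + h) (R + h)).comp_add_right h
  simp only [add_sub_cancel_right] at this
  rwa [intervalIntegrable_iff_integrableOn_Icc_of_le (by linarith)] at this

lemma posPow_hasDerivAt {r s : ℝ} (hr0 : r ≠ 0) (hr1 : r ≠ 1) (hs : s ≠ 0) :
    HasDerivAt (posPow r) (r * posPow (r - 1) s) s := by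
  rcases lt_or_gt_of_ne hs with h | h
  · have e : posPow r =ᶠ[𝓝 s] fun _ => 0 := by
      filter_upwards [Iio_mem_nhds h] with y hy using posPow_of_nonpos hr0 (le_of_lt hy)
    rw [posPow_of_nonpos (sub_ne_zero.mpr hr1) h.le, mul_zero]
    exact (hasDerivAt_const s (0:ℝ)).congr_of_eventuallyEq e
  · have e : posPow r =ᶠ[𝓝 s] fun y => y ^ r := by
      filter_upwards [Ioi_mem_nhds h] with y hy using posPow_of_nonneg (le_of_lt hy)
    rw [posPow_of_nonneg h.le]
    exact (Real.hasDerivAt_rpow_const (Or.inl hs)).congr_of_eventuallyEq e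

/-- increment bound away from the singularity -/
lemma posPow_far {β s h : ℝ} (hβ0 : 0 < β) (hs : 2 * |h| < |s|) :
    |posPow (-β) (s + h) - posPow (-β) s| ≤ β * 2 ^ (β + 1) * posPow (-β - 1) s * |h| := by
  have hh := abs_le.mp (le_refl |h|)
  rcases le_total s 0 with h0 | h0
  · rw [abs_of_nonpos h0] at hs
    rw [posPow_of_nonpos (by linarith) h0, posPow_of_nonpos (by linarith) (by linarith [abs_nonneg h]),
      posPow_of_nonpos (by linarith) h0]
    simp
  · rw [abs_of_nonneg h0] at hs
    have hs0 : 0 < s := by linarith [abs_nonneg h]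
    have key := (convex_Ici (s / 2)).norm_image_sub_le_of_norm_hasDerivWithin_le
      (f := posPow (-β)) (f' := fun y => (-β) * posPow (-β - 1) y)
      (C := β * 2 ^ (β + 1) * posPow (-β - 1) s) (x := s) (y := s + h)
      (fun y hy => (posPow_hasDerivAt (by linarith) (by linarith)
        (by have : s / 2 ≤ y := hy; linarith)).hasDerivWithinAt)
      (by
        intro y hy
        have hy' : s / 2 ≤ y := hy
        have hy0 : 0 < y := by linarith
        rw [norm_mul, norm_neg, Real.norm_of_nonneg hβ0.le, Real.norm_of_nonneg (posPow_nonneg _ _),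
          mul_assoc]
        refine mul_le_mul_of_nonneg_left ?_ hβ0.le
        rw [posPow_of_nonneg hy0.le, posPow_of_nonneg h0]
        calc y ^ (-β - 1) ≤ (s / 2) ^ (-β - 1) :=
              Real.rpow_le_rpow_of_nonpos (by linarith) hy' (by linarith)
          _ = 2 ^ (β + 1) * s ^ (-β - 1) := by
              rw [Real.div_rpow h0 (by norm_num), show -β - 1 = -(β + 1) by ring,
                Real.rpow_neg (by norm_num : (0:ℝ) ≤ 2)]
              field_simp)
      (by show s / 2 ≤ s; linarith) (by show s / 2 ≤ s + h; linarith)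
    simpa using key

section
variable {β β' C R : ℝ} {ρ : ℝ → ℝ}

lemma shift_mul_integrable (hβ0 : 0 < β) (hβ1 : β < 1) (hβ' : β < β') (hC : 0 ≤ C)
    (hR : 0 ≤ R)
    (hm : AEStronglyMeasurable ρ volume) (hρ : ∀ s, |ρ s| ≤ C * |s| ^ β')
    (hsupp : ∀ s, R < |s| → ρ s = 0) (h : ℝ) :
    Integrable (fun s => posPow (-β) (s + h) * ρ s) := by
  rw [← integrableOn_iff_integrable_of_support_subset (s := Icc (-R) R)]
  · refine Integrable.mul_bdd (c := C * R ^ β')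
      (posPow_shift_integrable (by linarith) (by linarith) h R hR) hm.restrict ?_
    refine (ae_restrict_iff' measurableSet_Icc).mpr (Eventually.of_forall fun s hs => ?_)
    refine (hρ s).trans (mul_le_mul_of_nonneg_left ?_ hC)
    exact Real.rpow_le_rpow (abs_nonneg _) (abs_le.mpr hs) (by linarith)
  · intro s hs
    by_contra hn
    apply hs
    have : R < |s| := by
      by_contra h'
      exact hn (abs_le.mp (not_lt.mp h'))
    simp [hsupp s this]

lemma near_bound (hβ0 : 0 < β) (hβ1 : β < 1) (hβ' : β < β') (hC : 0 ≤ C)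
    (hρ : ∀ s, |ρ s| ≤ C * |s| ^ β') (h : ℝ) (hh : h ≠ 0) :
    ‖∫ s, (Icc (-(2 * |h|)) (2 * |h|)).indicator
      (fun s => h⁻¹ * ((posPow (-β) (s + h) - posPow (-β) s) * ρ s)) s‖ ≤
      (C * 2 ^ β' * 2 * 3 ^ (1 - β) / (1 - β)) * |h| ^ (β' - β) := by
  have hr : 0 < |h| := abs_pos.mpr hh
  have hh' := abs_le.mp (le_refl |h|)
  set r := |h| with hrdef
  rw [integral_indicator measurableSet_Icc]
  have i1 := posPow_shift_integrable (r := -β) (by linarith) (by linarith) h (2 * r) (by linarith)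
  have i0 := posPow_shift_integrable (r := -β) (by linarith) (by linarith) 0 (2 * r) (by linarith)
  simp only [add_zero] at i0
  have b1 : ∫ s in Icc (-(2 * r)) (2 * r), posPow (-β) (s + h) ≤
      (3 * r) ^ (1 - β) / (1 - β) := by
    rw [integral_Icc_eq_integral_Ioc, ← intervalIntegral.integral_of_le (by linarith),
      intervalIntegral.integral_comp_add_right (fun s => posPow (-β) s)]
    have := intervalIntegral.integral_mono_interval (f := posPow (-β)) (μ := volume)
      (a := -(2 * r) + h) (b := 2 * r + h) (c := -(3 * r)) (d := 3 * r) (by linarith)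
      (by linarith) (by linarith) (Eventually.of_forall fun s => posPow_nonneg _ _)
      (posPow_intervalIntegrable (by linarith) (by linarith) _ _)
    rw [posPow_integral (R := 3 * r) (by linarith) (by linarith) (by linarith)] at this
    rwa [show -β + 1 = 1 - β by ring] at this
  have b0 : ∫ s in Icc (-(2 * r)) (2 * r), posPow (-β) s ≤
      (3 * r) ^ (1 - β) / (1 - β) := by
    rw [integral_Icc_eq_integral_Ioc, ← intervalIntegral.integral_of_le (by linarith)]
    have := intervalIntegral.integral_mono_interval (f := posPow (-β)) (μ := volume)
      (a := -(2 * r)) (b := 2 * r) (c := -(3 * r)) (d := 3 * r) (by linarith)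
      (by linarith) (by linarith) (Eventually.of_forall fun s => posPow_nonneg _ _)
      (posPow_intervalIntegrable (by linarith) (by linarith) _ _)
    rw [posPow_integral (R := 3 * r) (by linarith) (by linarith) (by linarith)] at this
    rwa [show -β + 1 = 1 - β by ring] at this
  have step : ‖∫ s in Icc (-(2 * r)) (2 * r),
      h⁻¹ * ((posPow (-β) (s + h) - posPow (-β) s) * ρ s)‖ ≤
      ∫ s in Icc (-(2 * r)) (2 * r),
        (r⁻¹ * (C * (2 * r) ^ β')) * (posPow (-β) (s + h) + posPow (-β) s) := by
    refine norm_integral_le_of_norm_le ((i1.add i0).const_mul _) ?_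
    refine (ae_restrict_iff' measurableSet_Icc).mpr (Eventually.of_forall fun s hs => ?_)
    rw [norm_mul, norm_mul, norm_inv, Real.norm_eq_abs, Real.norm_eq_abs, Real.norm_eq_abs,
      ← hrdef, mul_assoc]
    refine mul_le_mul_of_nonneg_left ?_ (by positivity)
    rw [mul_comm]
    refine mul_le_mul ?_ ?_ (abs_nonneg _) (by positivity)
    · refine (hρ s).trans (mul_le_mul_of_nonneg_left ?_ hC)
      exact Real.rpow_le_rpow (abs_nonneg _) (abs_le.mpr hs) (by linarith)
    · have p1 := posPow_nonneg (-β) (s + h)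
      have p2 := posPow_nonneg (-β) s
      rw [abs_le]; constructor <;> linarith
  refine step.trans ?_
  rw [integral_const_mul, integral_add i1 i0]
  calc _ ≤ (r⁻¹ * (C * (2 * r) ^ β')) * ((3 * r) ^ (1 - β) / (1 - β) + (3 * r) ^ (1 - β) / (1 - β)) :=
        mul_le_mul_of_nonneg_left (add_le_add b1 b0) (by positivity)
    _ = _ := by
      rw [Real.mul_rpow (by norm_num) hr.le, Real.mul_rpow (by norm_num) hr.le,
        show β' - β = -1 + β' + (1 - β) by ring, Real.rpow_add hr, Real.rpow_add hr,
        Real.rpow_neg_one]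
      ring

lemma conv_hasDerivAt (hβ0 : 0 < β) (hβ1 : β < 1) (hβ' : β < β') (hβ'1 : β' < 1) (hC : 0 ≤ C)
    (hR : 0 ≤ R)
    (hm : AEStronglyMeasurable ρ volume) (hρ : ∀ s, |ρ s| ≤ C * |s| ^ β')
    (hsupp : ∀ s, R < |s| → ρ s = 0) :
    Integrable (fun s => (-β) * posPow (-β - 1) s * ρ s) ∧
    HasDerivAt (fun h => ∫ s, posPow (-β) (s + h) * ρ s)
      (∫ s, (-β) * posPow (-β - 1) s * ρ s) 0 := by
  have hint := shift_mul_integrable hβ0 hβ1 hβ' hC hR hm hρ hsupp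
  have hBi : Integrable ((Icc (-R) R).indicator
      (fun s => (β * 2 ^ (β + 1) * C) * posPow (β' - β - 1) s)) := by
    rw [integrable_indicator_iff measurableSet_Icc]
    have := posPow_shift_integrable (r := β' - β - 1) (by linarith) (by linarith) 0 R hR
    simp only [add_zero] at this
    exact this.const_mul _
  have hprod : ∀ s, posPow (-β - 1) s * |ρ s| ≤
      (Icc (-R) R).indicator (fun s => C * posPow (β' - β - 1) s) s := by
    intro s
    by_cases hs : s ∈ Icc (-R) R
    · rw [indicator_of_mem hs]
      rcases le_or_gt s 0 with h0 | h0
      · rw [posPow_of_nonpos (by linarith) h0, posPow_of_nonpos (by linarith) h0]; simp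
      · refine (mul_le_mul_of_nonneg_left (hρ s) (posPow_nonneg _ _)).trans (le_of_eq ?_)
        rw [posPow_of_nonneg h0.le, posPow_of_nonneg h0.le, abs_of_pos h0,
          show β' - β - 1 = (-β - 1) + β' by ring, Real.rpow_add h0]
        ring
    · rw [indicator_of_notMem hs]
      have : R < |s| := by
        by_contra h'
        exact hs (abs_le.mp (not_lt.mp h'))
      simp [hsupp s this]
  have h2β : (1:ℝ) ≤ 2 ^ (β + 1) := Real.one_le_rpow (by norm_num) (by linarith)
  have hBval : ∀ s, (Icc (-R) R).indicator
      (fun s => (β * 2 ^ (β + 1) * C) * posPow (β' - β - 1) s) s =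
      β * 2 ^ (β + 1) * (Icc (-R) R).indicator (fun s => C * posPow (β' - β - 1) s) s := by
    intro s
    by_cases hs : s ∈ Icc (-R) R
    · simp only [indicator_of_mem hs]; ring
    · simp only [indicator_of_notMem hs]; ring
  refine ⟨?_, ?_⟩
  · refine hBi.mono' ((((posPow_measurable _).aestronglyMeasurable).const_mul _).mul hm)
      (Eventually.of_forall fun s => ?_)
    rw [hBval, norm_mul, norm_mul, norm_neg, Real.norm_of_nonneg hβ0.le,
      Real.norm_of_nonneg (posPow_nonneg _ _), Real.norm_eq_abs, mul_assoc, mul_assoc]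
    refine mul_le_mul_of_nonneg_left ?_ hβ0.le
    have h0 : 0 ≤ posPow (-β - 1) s * |ρ s| := mul_nonneg (posPow_nonneg _ _) (abs_nonneg _)
    calc _ ≤ 2 ^ (β + 1) * (posPow (-β - 1) s * |ρ s|) := by nlinarith
      _ ≤ _ := mul_le_mul_of_nonneg_left (hprod s) (by linarith)
  rw [hasDerivAt_iff_tendsto_slope_zero]
  simp only [zero_add, add_zero, smul_eq_mul]
  set G : ℝ → ℝ → ℝ := fun h s => h⁻¹ * ((posPow (-β) (s + h) - posPow (-β) s) * ρ s) with hG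
  have hGi : ∀ h, Integrable (G h) := by
    intro h
    have h0 := hint 0
    simp only [add_zero] at h0
    have := ((hint h).sub h0).const_mul h⁻¹
    refine this.congr (Eventually.of_forall fun s => ?_)
    simp only [hG, Pi.sub_apply]; ring
  have hslope : ∀ h, h⁻¹ * ((∫ s, posPow (-β) (s + h) * ρ s) - ∫ s, posPow (-β) s * ρ s)
      = ∫ s, G h s := by
    intro h
    have h0 := hint 0
    simp only [add_zero] at h0
    rw [← integral_sub (hint h) h0, ← integral_const_mul]
    refine integral_congr_ae (Eventually.of_forall fun s => ?_)
    simp only [hG]; ring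
  have hsplit : ∀ h, ∫ s, G h s =
      (∫ s, (Icc (-(2 * |h|)) (2 * |h|)).indicator (G h) s) +
      ∫ s, (Icc (-(2 * |h|)) (2 * |h|))ᶜ.indicator (G h) s := by
    intro h
    rw [integral_indicator measurableSet_Icc, integral_indicator measurableSet_Icc.compl,
      integral_add_compl measurableSet_Icc (hGi h)]
  simp_rw [hslope, hsplit]
  rw [← zero_add (∫ s, (-β) * posPow (-β - 1) s * ρ s)]
  refine Tendsto.add ?_ ?_
  · rw [tendsto_zero_iff_norm_tendsto_zero]
    have hz : Tendsto (fun h : ℝ =>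
        (C * 2 ^ β' * 2 * 3 ^ (1 - β) / (1 - β)) * |h| ^ (β' - β)) (𝓝[≠] 0) (𝓝 0) := by
      have hc : Continuous (fun h : ℝ =>
        (C * 2 ^ β' * 2 * 3 ^ (1 - β) / (1 - β)) * |h| ^ (β' - β)) :=
        continuous_const.mul (continuous_abs.rpow_const fun _ => Or.inr (by linarith))
      have := hc.tendsto 0
      simp only [abs_zero, Real.zero_rpow (sub_ne_zero.mpr hβ'.ne'), mul_zero] at this
      exact this.mono_left nhdsWithin_le_nhds
    refine tendsto_of_tendsto_of_tendsto_of_le_of_le' tendsto_const_nhds hz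
      (Eventually.of_forall fun _ => norm_nonneg _) ?_
    filter_upwards [self_mem_nhdsWithin] with h hh
    exact near_bound hβ0 hβ1 hβ' hC hρ h hh
  · refine tendsto_integral_filter_of_dominated_convergence _ ?_ ?_ hBi ?_
    · exact Eventually.of_forall fun h =>
        (hGi h).aestronglyMeasurable.indicator measurableSet_Icc.compl
    · filter_upwards [self_mem_nhdsWithin] with h hh
      refine Eventually.of_forall fun s => ?_
      have hh : h ≠ 0 := hh
      by_cases hs : s ∈ Icc (-(2 * |h|)) (2 * |h|)
      · rw [indicator_of_notMem (by simpa using hs), norm_zero, hBval]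
        exact mul_nonneg (by positivity) (indicator_nonneg
          (fun s _ => mul_nonneg hC (posPow_nonneg _ _)) s)
      · rw [indicator_of_mem (by simpa using hs), hBval]
        have hs' : 2 * |h| < |s| := by
          by_contra h'
          exact hs (abs_le.mp (not_lt.mp h'))
        have hf := posPow_far hβ0 hs'
        have hp := hprod s
        simp only [hG]
        rw [norm_mul, norm_mul, norm_inv, Real.norm_eq_abs, Real.norm_eq_abs, Real.norm_eq_abs]
        have hpos : 0 < |h| := abs_pos.mpr hh
        calc |h|⁻¹ * (|posPow (-β) (s + h) - posPow (-β) s| * |ρ s|)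
            ≤ |h|⁻¹ * ((β * 2 ^ (β + 1) * posPow (-β - 1) s * |h|) * |ρ s|) := by gcongr
          _ = β * 2 ^ (β + 1) * (posPow (-β - 1) s * |ρ s|) := by field_simp
          _ ≤ _ := mul_le_mul_of_nonneg_left hp (by positivity)
    · have hae : ∀ᵐ s : ℝ, s ≠ 0 := by
        simp [ae_iff]
      filter_upwards [hae] with s hs
      have hd := (hasDerivAt_iff_tendsto_slope_zero.mp
        (posPow_hasDerivAt (r := -β) (by linarith) (by linarith) hs)).mul_const (ρ s)
      refine hd.congr' ?_
      have hev : ∀ᶠ h : ℝ in 𝓝[≠] 0, |h| < |s| / 2 := by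
        refine nhdsWithin_le_nhds ?_
        have := (continuous_abs.tendsto (0:ℝ)).eventually
          (Iio_mem_nhds (show |(0:ℝ)| < |s| / 2 by simpa using hs))
        exact this
      filter_upwards [hev] with h hh
      rw [indicator_of_mem]
      · simp only [hG, smul_eq_mul]; ring
      · intro hs'
        have := abs_le.mpr hs'
        linarith
end

lemma conv_indicator {r s T : ℝ} (hr : r ≠ 0) (hsT : s ≤ T) (φ : ℝ → ℝ) :
    (fun τ => posPow r (s - τ) * (Icc 0 T).indicator φ τ) =
      (Icc 0 s).indicator (fun τ => (s - τ) ^ r * φ τ) := by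
  funext τ
  by_cases h : τ ∈ Icc 0 s
  · have h2 : τ ∈ Icc 0 T := ⟨h.1, h.2.trans hsT⟩
    rw [indicator_of_mem h, indicator_of_mem h2,
      posPow_of_nonneg (by linarith [h.2])]
  · rw [indicator_of_notMem h]
    by_cases h2 : 0 ≤ τ
    · have : s < τ := by
        by_contra h3
        exact h ⟨h2, not_lt.mp h3⟩
      rw [posPow_of_nonpos hr (by linarith), zero_mul]
    · rw [indicator_of_notMem (fun h3 => h2 h3.1), mul_zero]

lemma conv_integral {r s T : ℝ} (hr : r ≠ 0) (hs : 0 ≤ s) (hsT : s ≤ T) (φ : ℝ → ℝ) :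
    ∫ τ, posPow r (s - τ) * (Icc 0 T).indicator φ τ = ∫ τ in (0:ℝ)..s, (s - τ) ^ r * φ τ := by
  rw [conv_indicator hr hsT, integral_indicator measurableSet_Icc, integral_Icc_eq_integral_Ioc,
    intervalIntegral.integral_of_le hs]

lemma conv_intervalIntegrable {r s T : ℝ} (hr : r ≠ 0) (hs : 0 ≤ s) (hsT : s ≤ T) (φ : ℝ → ℝ)
    (h : Integrable (fun τ => posPow r (s - τ) * (Icc 0 T).indicator φ τ)) :
    IntervalIntegrable (fun τ => (s - τ) ^ r * φ τ) volume 0 s := by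
  rw [conv_indicator hr hsT, integrable_indicator_iff measurableSet_Icc] at h
  rwa [intervalIntegrable_iff_integrableOn_Icc_of_le hs]

lemma holder_continuousOn {β' C T : ℝ} (hβ' : 0 < β') {w : ℝ → ℝ}
    (hw : ∀ s ∈ Icc (0:ℝ) T, ∀ t ∈ Icc (0:ℝ) T, |w t - w s| ≤ C * |t - s| ^ β') :
    ContinuousOn w (Icc 0 T) := by
  intro s hs
  rw [ContinuousWithinAt, tendsto_iff_norm_sub_tendsto_zero]
  have hz : Tendsto (fun t : ℝ => C * |t - s| ^ β') (𝓝[Icc 0 T] s) (𝓝 0) := by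
    have hc : Continuous (fun t : ℝ => C * |t - s| ^ β') :=
      continuous_const.mul ((continuous_abs.comp (continuous_id.sub continuous_const)).rpow_const
        fun _ => Or.inr hβ'.le)
    have := hc.tendsto s
    simp only [sub_self, abs_zero, Real.zero_rpow hβ'.ne', mul_zero] at this
    exact this.mono_left nhdsWithin_le_nhds
  refine tendsto_of_tendsto_of_tendsto_of_le_of_le' tendsto_const_nhds hz
    (Eventually.of_forall fun _ => norm_nonneg _) ?_
  filter_upwards [self_mem_nhdsWithin] with t ht
  exact hw s hs t ht

lemma frac_deriv {β β' C T t : ℝ} {w : ℝ → ℝ} (hβ0 : 0 < β) (hβ1 : β < 1) (hβ' : β < β')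
    (hβ'1 : β' < 1) (ht : t ∈ Ioo 0 T)
    (hw : ∀ s ∈ Icc (0:ℝ) T, ∀ t ∈ Icc (0:ℝ) T, |w t - w s| ≤ C * |t - s| ^ β') :
    IntervalIntegrable (fun τ => (t - τ) ^ (-β - 1) * (w τ - w t)) volume 0 t ∧
    HasDerivAt (fun s => ∫ τ in (0:ℝ)..s, (s - τ) ^ (-β) * w τ)
      (t ^ (-β) * w t - β * ∫ τ in (0:ℝ)..t, (t - τ) ^ (-β - 1) * (w τ - w t)) t := by
  have htI : t ∈ Icc 0 T := ⟨ht.1.le, ht.2.le⟩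
  have hT : 0 ≤ T := ht.1.le.trans ht.2.le
  have hwc := holder_continuousOn (by linarith) hw
  set ψ : ℝ → ℝ := (Icc 0 T).indicator (fun τ => w τ - w t) with hψ
  have hψm : AEStronglyMeasurable ψ volume := by
    rw [hψ, aestronglyMeasurable_indicator_iff measurableSet_Icc]
    exact (hwc.sub continuousOn_const).aestronglyMeasurable measurableSet_Icc
  set ρ : ℝ → ℝ := fun s => ψ (t - s) with hρ
  have hρm : AEStronglyMeasurable ρ volume :=
    hψm.comp_quasiMeasurePreserving (quasiMeasurePreserving_sub_left volume t)
  have hρb : ∀ s, |ρ s| ≤ |C| * |s| ^ β' := by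
    intro s
    by_cases hs : t - s ∈ Icc 0 T
    · simp only [hρ, hψ, indicator_of_mem hs]
      have h1 := hw t htI (t - s) hs
      rw [show t - s - t = -s by ring, abs_neg] at h1
      exact h1.trans (mul_le_mul_of_nonneg_right (le_abs_self C) (by positivity))
    · simp only [hρ, hψ, indicator_of_notMem hs, abs_zero]; positivity
  have hsupp : ∀ s, T < |s| → ρ s = 0 := by
    intro s hs
    simp only [hρ, hψ]
    apply indicator_of_notMem
    intro h
    have h1 := h.1
    have h2 := h.2
    have : |s| ≤ T := abs_le.mpr ⟨by linarith [ht.1], by linarith [ht.2]⟩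
    linarith
  have hsh := shift_mul_integrable hβ0 hβ1 hβ' (abs_nonneg C) hT hρm hρb hsupp
  obtain ⟨hDi, hDd⟩ := conv_hasDerivAt hβ0 hβ1 hβ' hβ'1 (abs_nonneg C) hT hρm hρb hsupp
  have eF : ∀ s ∈ Ioo 0 T, ∫ σ, posPow (-β) (σ + (s - t)) * ρ σ =
      ∫ τ in (0:ℝ)..s, (s - τ) ^ (-β) * (w τ - w t) := by
    intro s hs
    rw [← conv_integral (by linarith) hs.1.le hs.2.le,
      ← integral_sub_left_eq_self (fun τ => posPow (-β) (s - τ) * ψ τ) volume t]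
    refine integral_congr_ae (Eventually.of_forall fun σ => ?_)
    simp only [hρ]
    rw [show s - (t - σ) = σ + (s - t) by ring]
  have iF : ∀ s ∈ Ioo 0 T,
      IntervalIntegrable (fun τ => (s - τ) ^ (-β) * (w τ - w t)) volume 0 s := by
    intro s hs
    apply conv_intervalIntegrable (by linarith) hs.1.le hs.2.le
    have := (hsh (s - t)).comp_sub_left t
    refine this.congr (Eventually.of_forall fun τ => ?_)
    simp only [hρ, hψ, sub_sub_cancel]
    rw [show t - τ + (s - t) = s - τ by ring]
  have hDi2 : Integrable (fun τ => (-β) * (posPow (-β - 1) (t - τ) * ψ τ)) := by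
    refine (hDi.comp_sub_left t).congr (Eventually.of_forall fun τ => ?_)
    simp only [hρ, sub_sub_cancel]; ring
  have hDi3 : Integrable (fun τ => posPow (-β - 1) (t - τ) * ψ τ) := by
    refine (hDi2.const_mul (-β)⁻¹).congr (Eventually.of_forall fun τ => ?_)
    field_simp
  have eD : ∫ s, (-β) * posPow (-β - 1) s * ρ s =
      - (β * ∫ τ in (0:ℝ)..t, (t - τ) ^ (-β - 1) * (w τ - w t)) := by
    rw [← conv_integral (by linarith) htI.1 htI.2,
      ← integral_sub_left_eq_self (fun τ => posPow (-β - 1) (t - τ) * ψ τ) volume t,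
      ← neg_mul, ← integral_const_mul]
    refine integral_congr_ae (Eventually.of_forall fun σ => ?_)
    simp only [hρ, sub_sub_cancel]; ring
  refine ⟨conv_intervalIntegrable (by linarith) htI.1 htI.2 _ hDi3, ?_⟩
  have d1 : HasDerivAt (fun s => ∫ σ, posPow (-β) (σ + (s - t)) * ρ σ)
      (- (β * ∫ τ in (0:ℝ)..t, (t - τ) ^ (-β - 1) * (w τ - w t))) t := by
    rw [← eD]
    have h0 : HasDerivAt (fun s => s - t) 1 t := (hasDerivAt_id t).sub_const t
    have h1 := HasDerivAt.comp (h₂ := fun h => ∫ s, posPow (-β) (s + h) * ρ s) (h := fun s => s - t)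
      t (by rw [sub_self]; exact hDd) h0
    rw [mul_one] at h1
    exact h1
  have d2 : HasDerivAt (fun s : ℝ => s ^ (1 - β) / (1 - β) * w t) (t ^ (-β) * w t) t := by
    have h1 := ((Real.hasDerivAt_rpow_const (p := 1 - β) (x := t) (Or.inl ht.1.ne')).div_const
      (1 - β)).mul_const (w t)
    refine h1.congr_deriv ?_
    rw [show 1 - β - 1 = -β by ring]
    have : (1 - β) ≠ 0 := by linarith
    field_simp
  have d3 := (d2.add d1)
  rw [← sub_eq_add_neg] at d3
  refine d3.congr_of_eventuallyEq ?_
  filter_upwards [Ioo_mem_nhds ht.1 ht.2] with s hs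
  have i2 : IntervalIntegrable (fun τ => (s - τ) ^ (-β)) volume 0 s := by
    have := (intervalIntegral.intervalIntegrable_rpow' (r := -β) (by linarith) (a := s)
      (b := 0)).comp_sub_left s
    simpa using this
  have e2 : ∫ τ in (0:ℝ)..s, (s - τ) ^ (-β) = s ^ (1 - β) / (1 - β) := by
    rw [intervalIntegral.integral_comp_sub_left (fun σ => σ ^ (-β)) s, sub_self, sub_zero,
      integral_rpow (Or.inl (by linarith)), Real.zero_rpow (by linarith), sub_zero,
      show -β + 1 = 1 - β by ring]
  simp only [Pi.add_apply]
  rw [eF s hs, ← e2, ← intervalIntegral.integral_mul_const, ← intervalIntegral.integral_add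
    (i2.mul_const _) (iF s hs)]
  refine intervalIntegral.integral_congr fun τ _ => ?_
  ring

lemma RLD_eq {β β' C T t : ℝ} {w : ℝ → ℝ} (hβ0 : 0 < β) (hβ1 : β < 1) (hβ' : β < β')
    (hβ'1 : β' < 1) (ht : t ∈ Ioo 0 T)
    (hw : ∀ s ∈ Icc (0:ℝ) T, ∀ t ∈ Icc (0:ℝ) T, |w t - w s| ≤ C * |t - s| ^ β') :
    RLD β T w t = (Real.Gamma (1 - β))⁻¹ *
      (t ^ (-β) * w t - β * ∫ τ in (0:ℝ)..t, (t - τ) ^ (-β - 1) * (w τ - w t)) := by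
  rw [RLD, derivWithin_of_mem_nhds (Icc_mem_nhds ht.1 ht.2)]
  exact ((frac_deriv hβ0 hβ1 hβ' hβ'1 ht hw).2.const_mul _).deriv

lemma RLD_sub {β β' C₁ C₂ C₃ T t c : ℝ} {w₁ w₂ : ℝ → ℝ} (hβ0 : 0 < β) (hβ1 : β < 1) (hβ' : β < β')
    (hβ'1 : β' < 1) (ht : t ∈ Ioo 0 T)
    (hw₁ : ∀ s ∈ Icc (0:ℝ) T, ∀ t ∈ Icc (0:ℝ) T, |w₁ t - w₁ s| ≤ C₁ * |t - s| ^ β')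
    (hw₂ : ∀ s ∈ Icc (0:ℝ) T, ∀ t ∈ Icc (0:ℝ) T, |w₂ t - w₂ s| ≤ C₂ * |t - s| ^ β')
    (hw₃ : ∀ s ∈ Icc (0:ℝ) T, ∀ t ∈ Icc (0:ℝ) T,
      |(w₁ t - w₂ t) - (w₁ s - w₂ s)| ≤ C₃ * |t - s| ^ β') :
    RLD β T (fun τ => w₁ τ - w₂ τ) t =
      RLD β T (fun τ => w₁ τ - c) t - RLD β T (fun τ => w₂ τ - c) t := by
  have h1 : ∀ s ∈ Icc (0:ℝ) T, ∀ t ∈ Icc (0:ℝ) T,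
      |(w₁ t - c) - (w₁ s - c)| ≤ C₁ * |t - s| ^ β' := by
    intro s hs t ht; rw [sub_sub_sub_cancel_right]; exact hw₁ s hs t ht
  have h2 : ∀ s ∈ Icc (0:ℝ) T, ∀ t ∈ Icc (0:ℝ) T,
      |(w₂ t - c) - (w₂ s - c)| ≤ C₂ * |t - s| ^ β' := by
    intro s hs t ht; rw [sub_sub_sub_cancel_right]; exact hw₂ s hs t ht
  rw [RLD_eq hβ0 hβ1 hβ' hβ'1 ht h1, RLD_eq hβ0 hβ1 hβ' hβ'1 ht h2,
    RLD_eq hβ0 hβ1 hβ' hβ'1 ht hw₃]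
  have e : ∫ τ in (0:ℝ)..t, (t - τ) ^ (-β - 1) * (w₁ τ - w₂ τ - (w₁ t - w₂ t)) =
      (∫ τ in (0:ℝ)..t, (t - τ) ^ (-β - 1) * (w₁ τ - c - (w₁ t - c))) -
      ∫ τ in (0:ℝ)..t, (t - τ) ^ (-β - 1) * (w₂ τ - c - (w₂ t - c)) := by
    rw [← intervalIntegral.integral_sub (frac_deriv hβ0 hβ1 hβ' hβ'1 ht h1).1
      (frac_deriv hβ0 hβ1 hβ' hβ'1 ht h2).1]
    refine intervalIntegral.integral_congr fun τ _ => ?_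
    ring
  rw [e]; ring

lemma RLD_lower {β β' C T t a : ℝ} {w : ℝ → ℝ} (hβ0 : 0 < β) (hβ1 : β < 1) (hβ' : β < β')
    (hβ'1 : β' < 1) (ht : t ∈ Ioo 0 T)
    (hw : ∀ s ∈ Icc (0:ℝ) T, ∀ t ∈ Icc (0:ℝ) T, |w t - w s| ≤ C * |t - s| ^ β')
    (ha0 : 0 ≤ a) (hat : a < t) (hmax : ∀ s ∈ Icc 0 t, w s ≤ w t) (hza : ∀ s ∈ Icc 0 a, w s ≤ 0) :
    (Real.Gamma (1 - β))⁻¹ * ((t - a) ^ (-β) * w t) ≤ RLD β T w t := by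
  rw [RLD_eq hβ0 hβ1 hβ' hβ'1 ht hw]
  have hi := (frac_deriv hβ0 hβ1 hβ' hβ'1 ht hw).1
  refine mul_le_mul_of_nonneg_left ?_
    (inv_nonneg.mpr (Real.Gamma_pos_of_pos (by linarith)).le)
  have hi1 : IntervalIntegrable (fun τ => (t - τ) ^ (-β - 1) * (w τ - w t)) volume 0 a :=
    hi.mono_set (by rw [uIcc_of_le ha0, uIcc_of_le ht.1.le]; exact Icc_subset_Icc le_rfl hat.le)
  have hi2 : IntervalIntegrable (fun τ => (t - τ) ^ (-β - 1) * (w τ - w t)) volume a t :=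
    hi.mono_set (by rw [uIcc_of_le hat.le, uIcc_of_le ht.1.le]; exact Icc_subset_Icc ha0 le_rfl)
  rw [← intervalIntegral.integral_add_adjacent_intervals hi1 hi2]
  have h2 : ∫ τ in a..t, (t - τ) ^ (-β - 1) * (w τ - w t) ≤ 0 := by
    have := intervalIntegral.integral_mono_on hat.le hi2
      (intervalIntegrable_const (c := (0:ℝ))) (fun τ hτ => by
        have h1 := hmax τ ⟨ha0.trans hτ.1, hτ.2⟩
        exact mul_nonpos_of_nonneg_of_nonpos (Real.rpow_nonneg (by linarith [hτ.2]) _)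
          (by linarith))
    simpa using this
  have hnz : (0:ℝ) ∉ uIcc (t - a) (t - 0) := by
    rw [uIcc_of_le (by linarith)]
    intro h
    linarith [h.1]
  have hi3 : IntervalIntegrable (fun τ => (t - τ) ^ (-β - 1)) volume 0 a := by
    have := (intervalIntegral.intervalIntegrable_rpow (μ := volume) (r := -β - 1) (a := t - 0)
      (b := t - a) (Or.inr (by rwa [uIcc_comm]))).comp_sub_left t
    simpa using this
  have h1 : ∫ τ in (0:ℝ)..a, (t - τ) ^ (-β - 1) * (w τ - w t) ≤
      (t ^ (-β) - (t - a) ^ (-β)) / (-β) * (- w t) := by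
    have e : ∫ τ in (0:ℝ)..a, (t - τ) ^ (-β - 1) * (- w t) =
        (t ^ (-β) - (t - a) ^ (-β)) / (-β) * (- w t) := by
      rw [intervalIntegral.integral_mul_const,
        intervalIntegral.integral_comp_sub_left (fun σ => σ ^ (-β - 1)) t,
        integral_rpow (Or.inr ⟨by linarith, hnz⟩), sub_zero, sub_add_cancel]
    rw [← e]
    refine intervalIntegral.integral_mono_on ha0 hi1 (hi3.mul_const _) fun τ hτ => ?_
    exact mul_le_mul_of_nonneg_left (by linarith [hza τ hτ])
      (Real.rpow_nonneg (by linarith [hτ.2]) _)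
  have h3 : β * ((t ^ (-β) - (t - a) ^ (-β)) / (-β) * (- w t)) =
      (t ^ (-β) - (t - a) ^ (-β)) * w t := by field_simp
  nlinarith

lemma joint_continuousOn {n : ℕ} {β' C T : ℝ} (hβ' : 0 < β') {K : Set (Fin n → ℝ)}
    {w : ℝ → (Fin n → ℝ) → ℝ}
    (hc : ∀ t ∈ Icc (0:ℝ) T, ContinuousOn (w t) K)
    (hw : ∀ s ∈ Icc (0:ℝ) T, ∀ t ∈ Icc (0:ℝ) T, ∀ x ∈ K, |w t x - w s x| ≤ C * |t - s| ^ β') :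
    ContinuousOn (fun p : ℝ × (Fin n → ℝ) => w p.1 p.2) (Icc 0 T ×ˢ K) := by
  rintro ⟨s, y⟩ ⟨hs, hy⟩
  rw [ContinuousWithinAt, tendsto_iff_norm_sub_tendsto_zero]
  have h1 : ContinuousWithinAt (fun p : ℝ × (Fin n → ℝ) =>
      C * |p.1 - s| ^ β' + |w s p.2 - w s y|) (Icc 0 T ×ˢ K) (s, y) := by
    refine ContinuousWithinAt.add ?_ ?_
    · have : Continuous (fun p : ℝ × (Fin n → ℝ) => C * |p.1 - s| ^ β') :=
        continuous_const.mul ((continuous_abs.comp (continuous_fst.sub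
          continuous_const)).rpow_const fun _ => Or.inr hβ'.le)
      exact this.continuousWithinAt
    · have h2 : ContinuousWithinAt (fun p : ℝ × (Fin n → ℝ) => w s p.2) (Icc 0 T ×ˢ K) (s, y) :=
        ContinuousWithinAt.comp (t := K) (hc s hs y hy) continuousWithinAt_snd
          (fun p hp => hp.2)
      exact (h2.sub continuousWithinAt_const).abs
  have h2 := h1.tendsto
  simp only [sub_self, abs_zero, Real.zero_rpow hβ'.ne', mul_zero, add_zero] at h2
  refine tendsto_of_tendsto_of_tendsto_of_le_of_le' tendsto_const_nhds h2
    (Eventually.of_forall fun _ => norm_nonneg _) ?_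
  filter_upwards [self_mem_nhdsWithin] with p hp
  rw [Real.norm_eq_abs]
  calc |w p.1 p.2 - w s y| ≤ |w p.1 p.2 - w s p.2| + |w s p.2 - w s y| := abs_sub_le _ _ _
    _ ≤ _ := by
      gcongr
      exact hw s hs p.1 hp.1 p.2 hp.2

lemma core_nonpos {n : ℕ} {β β' C T M : ℝ} {Ω : Set (Fin n → ℝ)} (hβ0 : 0 < β) (hβ1 : β < 1)
    (hβ' : β < β') (hβ'1 : β' < 1) (hM : 0 < M) (hΩo : IsOpen Ω) (hΩb : Bornology.IsBounded Ω)
    (w : ℝ → (Fin n → ℝ) → ℝ)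
    (hc : ∀ t ∈ Icc (0:ℝ) T, ContinuousOn (w t) (closure Ω))
    (hw : ∀ s ∈ Icc (0:ℝ) T, ∀ t ∈ Icc (0:ℝ) T, ∀ x ∈ closure Ω,
      |w t x - w s x| ≤ C * |t - s| ^ β')
    (h0 : ∀ x ∈ closure Ω, w 0 x = 0)
    (hb : ∀ t ∈ Ioo (0:ℝ) T, ∀ x ∈ frontier Ω, w t x = 0)
    (hmax : ∀ t ∈ Ioo (0:ℝ) T, ∀ x ∈ Ω, IsLocalMax (w t) x → 0 < w t x →
      RLD β T (fun τ => w τ x) t ≤ M * w t x) :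
    ∀ t ∈ Ico (0:ℝ) T, ∀ x ∈ closure Ω, w t x ≤ 0 := by
  have hG : 0 < Real.Gamma (1 - β) := Real.Gamma_pos_of_pos (by linarith)
  set Q := Real.Gamma (1 - β) * M + 1 with hQ
  have hQ0 : 0 < Q := by positivity
  set δ := Q ^ (-(1 / β)) with hδ
  have hδ0 : 0 < δ := Real.rpow_pos_of_pos hQ0 _
  have hδQ : δ ^ (-β) = Q := by
    rw [hδ, ← Real.rpow_mul hQ0.le]
    have : -(1 / β) * -β = 1 := by field_simp
    rw [this, Real.rpow_one]
  have hcont := joint_continuousOn (by linarith) hc hw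
  have main : ∀ k : ℕ, ∀ t ∈ Ico (0:ℝ) T, t ≤ k * δ → ∀ x ∈ closure Ω, w t x ≤ 0 := by
    intro k
    induction k with
    | zero =>
      intro t ht htk x hx
      have : t = 0 := le_antisymm (by simpa using htk) ht.1
      rw [this, h0 x hx]
    | succ k ih =>
      intro b hbT hbk x hx
      by_contra hpos
      push Not at hpos
      have hsub : Icc 0 b ×ˢ closure Ω ⊆ Icc 0 T ×ˢ closure Ω :=
        prod_mono (Icc_subset_Icc le_rfl hbT.2.le) le_rfl
      obtain ⟨⟨t₀, x₀⟩, ⟨ht₀, hx₀⟩, hmx⟩ :=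
        (isCompact_Icc.prod hΩb.isCompact_closure).exists_isMaxOn
          ⟨(b, x), ⟨⟨hbT.1, le_rfl⟩, hx⟩⟩ (hcont.mono hsub)
      have hmx' : ∀ s ∈ Icc 0 b, ∀ y ∈ closure Ω, w s y ≤ w t₀ x₀ := fun s hs y hy =>
        hmx (show (s, y) ∈ Icc 0 b ×ˢ closure Ω from ⟨hs, hy⟩)
      have hm : 0 < w t₀ x₀ := hpos.trans_le (hmx' b ⟨hbT.1, le_rfl⟩ x hx)
      simp only [mem_Icc] at ht₀
      have hat : k * δ < t₀ := by
        by_contra h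
        have := ih t₀ ⟨ht₀.1, ht₀.2.trans_lt hbT.2⟩ (not_lt.mp h) x₀ hx₀
        linarith
      have ha0 : 0 ≤ k * δ := by positivity
      have ht : t₀ ∈ Ioo 0 T := ⟨ha0.trans_lt hat, ht₀.2.trans_lt hbT.2⟩
      have hxΩ : x₀ ∈ Ω := by
        by_contra h
        have : x₀ ∈ frontier Ω := by
          rw [hΩo.frontier_eq]; exact ⟨hx₀, h⟩
        linarith [hb t₀ ht x₀ this]
      have hloc : IsLocalMax (w t₀) x₀ := by
        filter_upwards [hΩo.mem_nhds hxΩ] with y hy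
        exact hmx' t₀ ht₀ y (subset_closure hy)
      have hup := hmax t₀ ht x₀ hxΩ hloc hm
      have hlo := RLD_lower (w := fun τ => w τ x₀) hβ0 hβ1 hβ' hβ'1 ht
        (fun s hs t ht => hw s hs t ht x₀ hx₀) ha0 hat
        (fun s hs => hmx' s ⟨hs.1, hs.2.trans ht₀.2⟩ x₀ hx₀)
        (fun s hs => ih s ⟨hs.1, hs.2.trans_lt (hat.trans ht.2)⟩ hs.2 x₀ hx₀)
      have h1 : Q ≤ (t₀ - k * δ) ^ (-β) := by
        rw [← hδQ]
        refine Real.rpow_le_rpow_of_nonpos (by linarith) ?_ (by linarith)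
        push_cast at hbk
        linarith [ht₀.2]
      have h2 : (Real.Gamma (1 - β))⁻¹ * (Q * w t₀ x₀) ≤ M * w t₀ x₀ :=
        le_trans (by gcongr) (hlo.trans hup)
      rw [inv_mul_le_iff₀ hG, hQ] at h2
      nlinarith
  intro t ht x hx
  obtain ⟨k, hk⟩ := exists_nat_ge (t / δ)
  exact main k t ht (by rwa [div_le_iff₀ hδ0] at hk) x hx

lemma half_uniqueness {n : ℕ}
    (T β β' : ℝ) (hβ : β ∈ Ioo (0:ℝ) 1) (hβ' : β < β') (hβ'1 : β' < 1)
    (Ω : Set (Fin n → ℝ)) (hΩo : IsOpen Ω) (hΩb : Bornology.IsBounded Ω)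
    (aC : Fin n → Fin n → (Fin n → ℝ) → ℝ) (bC : Fin n → (Fin n → ℝ) → ℝ)
    (hell : IsElliptic aC Ω)
    (f : ℝ → ℝ → (Fin n → ℝ) → ℝ)
    (u₀ : (Fin n → ℝ) → ℝ) (g : ℝ → (Fin n → ℝ) → ℝ)
    (u₁ u₂ : ℝ → (Fin n → ℝ) → ℝ) (C₁ C₂ M : ℝ) (hT : 0 < T) (hM : 0 < M)
    (c₁ : ∀ t ∈ Icc (0:ℝ) T, ContinuousOn (u₁ t) (closure Ω))
    (c₂ : ∀ t ∈ Icc (0:ℝ) T, ContinuousOn (u₂ t) (closure Ω))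
    (w₁ : ∀ s ∈ Icc (0:ℝ) T, ∀ t ∈ Icc (0:ℝ) T, ∀ x ∈ closure Ω,
        |u₁ t x - u₁ s x| ≤ C₁ * |t - s| ^ β')
    (w₂ : ∀ s ∈ Icc (0:ℝ) T, ∀ t ∈ Icc (0:ℝ) T, ∀ x ∈ closure Ω,
        |u₂ t x - u₂ s x| ≤ C₂ * |t - s| ^ β')
    (d₁ : ∀ t ∈ Ioc (0:ℝ) T, ∀ x ∈ Ω,
        DifferentiableAt ℝ (u₁ t) x ∧ ∀ j, DifferentiableAt ℝ (pd j (u₁ t)) x)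
    (d₂ : ∀ t ∈ Ioc (0:ℝ) T, ∀ x ∈ Ω,
        DifferentiableAt ℝ (u₂ t) x ∧ ∀ j, DifferentiableAt ℝ (pd j (u₂ t)) x)
    (heq : ∀ v ∈ ({u₁, u₂} : Set (ℝ → (Fin n → ℝ) → ℝ)), ∀ t ∈ Ioo (0:ℝ) T, ∀ x ∈ Ω,
      RLD β T (fun τ => v τ x - u₀ x) t = ellOp aC bC (v t) x + f (v t x) t x)
    (hinit : ∀ v ∈ ({u₁, u₂} : Set (ℝ → (Fin n → ℝ) → ℝ)), ∀ x ∈ Ω, v 0 x = u₀ x)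
    (hbc : ∀ v ∈ ({u₁, u₂} : Set (ℝ → (Fin n → ℝ) → ℝ)), ∀ t ∈ Ioo (0:ℝ) T,
      ∀ x ∈ frontier Ω, v t x = g t x)
    (hLip : ∀ t ∈ Icc (0:ℝ) T, ∀ x ∈ closure Ω,
      |f (u₁ t x) t x - f (u₂ t x) t x| ≤ M * |u₁ t x - u₂ t x|) :
    ∀ t ∈ Icc (0:ℝ) T, ∀ x ∈ closure Ω, u₁ t x - u₂ t x ≤ 0 := by
  have m₁ : u₁ ∈ ({u₁, u₂} : Set (ℝ → (Fin n → ℝ) → ℝ)) := by simp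
  have m₂ : u₂ ∈ ({u₁, u₂} : Set (ℝ → (Fin n → ℝ) → ℝ)) := by simp
  have hz : (0:ℝ) ∈ Icc 0 T := ⟨le_rfl, hT.le⟩
  have hw : ∀ s ∈ Icc (0:ℝ) T, ∀ t ∈ Icc (0:ℝ) T, ∀ x ∈ closure Ω,
      |(u₁ t x - u₂ t x) - (u₁ s x - u₂ s x)| ≤ (C₁ + C₂) * |t - s| ^ β' := by
    intro s hs t ht x hx
    have h1 := w₁ s hs t ht x hx
    have h2 := w₂ s hs t ht x hx
    rw [show (u₁ t x - u₂ t x) - (u₁ s x - u₂ s x) = (u₁ t x - u₁ s x) - (u₂ t x - u₂ s x) by ring,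
      add_mul]
    exact (abs_sub _ _).trans (add_le_add h1 h2)
  have hIco := core_nonpos (M := M) hβ.1 hβ.2 hβ' hβ'1 hM hΩo hΩb (fun t x => u₁ t x - u₂ t x)
    (fun t ht => (c₁ t ht).sub (c₂ t ht)) hw
    (by
      have : EqOn (u₁ 0) (u₂ 0) (closure Ω) := by
        have he : EqOn (u₁ 0) (u₂ 0) Ω := fun x hx => by rw [hinit _ m₁ x hx, hinit _ m₂ x hx]
        exact he.of_subset_closure (c₁ 0 hz) (c₂ 0 hz) subset_closure le_rfl
      intro x hx
      exact sub_eq_zero.mpr (this hx))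
    (by
      intro t ht x hx
      simp only [hbc _ m₁ t ht x hx, hbc _ m₂ t ht x hx, sub_self])
    (by
      intro t ht x hx hloc hpos
      have htc : t ∈ Ioc (0:ℝ) T := ⟨ht.1, ht.2.le⟩
      have hxc := subset_closure hx
      have e1 : ∀ᶠ y in 𝓝 x, DifferentiableAt ℝ (u₁ t) y := by
        filter_upwards [hΩo.mem_nhds hx] with y hy using (d₁ t htc y hy).1
      have e2 : ∀ᶠ y in 𝓝 x, DifferentiableAt ℝ (u₂ t) y := by
        filter_upwards [hΩo.mem_nhds hx] with y hy using (d₂ t htc y hy).1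
      obtain ⟨hs1, hs2⟩ := ellOp_sub aC bC (u₁ t) (u₂ t) x e1 (d₁ t htc x hx).2 e2 (d₂ t htc x hx).2
      have hA := ellOp_nonpos aC bC (fun y => u₁ t y - u₂ t y) x
        (by
          obtain ⟨c, hc, h⟩ := hell
          intro ξ
          exact le_trans (mul_nonneg hc.le (Finset.sum_nonneg fun i _ => sq_nonneg _)) (h x hx ξ))
        (by filter_upwards [e1, e2] with y h1 h2 using h1.sub h2) hs1 hloc
      rw [RLD_sub (c := u₀ x) hβ.1 hβ.2 hβ' hβ'1 ht (fun s hs t ht => w₁ s hs t ht x hxc)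
        (fun s hs t ht => w₂ s hs t ht x hxc) (fun s hs t ht => hw s hs t ht x hxc),
        heq _ m₁ t ht x hx, heq _ m₂ t ht x hx]
      have hL := hLip t ⟨ht.1.le, ht.2.le⟩ x hxc
      rw [abs_of_pos hpos] at hL
      have := (le_abs_self _).trans hL
      linarith)
  intro t ht x hx
  have hcx : ContinuousOn (fun t => u₁ t x - u₂ t x) (Icc 0 T) :=
    holder_continuousOn (by linarith [hβ.1]) (fun s hs t ht => hw s hs t ht x hx)
  have hcl : Icc 0 T ⊆ closure (Ico 0 T) := by rw [closure_Ico hT.ne]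
  have hwi : ContinuousWithinAt (fun t => u₁ t x - u₂ t x) (Ico 0 T) t :=
    (hcx t ht).mono Ico_subset_Icc_self
  have hmem := hwi.mem_closure (t := Iic (0:ℝ)) (hcl ht) (fun s hs => hIco s hs x hx)
  rwa [isClosed_Iic.closure_eq] at hmem

/-- **Theorem A2 (uniqueness for the direct semilinear problem, Dirichlet case).** -/
theorem direct_problem_uniqueness {n : ℕ}
    (T β β' : ℝ) (hT : 0 < T) (hβ : β ∈ Ioo (0:ℝ) 1) (hβ' : β < β') (hβ'1 : β' < 1)
    (Ω : Set (Fin n → ℝ)) (hΩo : IsOpen Ω) (hΩb : Bornology.IsBounded Ω)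
    (aC : Fin n → Fin n → (Fin n → ℝ) → ℝ) (bC : Fin n → (Fin n → ℝ) → ℝ)
    (haC : ∀ i j, ContinuousOn (aC i j) (closure Ω))
    (hbC : ∀ j, ContinuousOn (bC j) (closure Ω))
    (hell : IsElliptic aC Ω)
    (f : ℝ → ℝ → (Fin n → ℝ) → ℝ)
    (hf : ContinuousOn (fun p : ℝ × ℝ × (Fin n → ℝ) => f p.1 p.2.1 p.2.2)
      ((univ : Set ℝ) ×ˢ (Icc 0 T ×ˢ closure Ω)))
    (u₀ : (Fin n → ℝ) → ℝ) (g : ℝ → (Fin n → ℝ) → ℝ)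
    (u₁ u₂ : ℝ → (Fin n → ℝ) → ℝ)
    (hreg : ∀ v ∈ ({u₁, u₂} : Set (ℝ → (Fin n → ℝ) → ℝ)),
      (∀ t ∈ Icc (0:ℝ) T, ContinuousOn (v t) (closure Ω)) ∧
      (∃ C : ℝ, ∀ s ∈ Icc (0:ℝ) T, ∀ t ∈ Icc (0:ℝ) T, ∀ x ∈ closure Ω,
        |v t x - v s x| ≤ C * |t - s| ^ β') ∧
      (∀ j, ContinuousOn (fun p : ℝ × (Fin n → ℝ) => pd j (v p.1) p.2)
        (Ioc 0 T ×ˢ closure Ω)) ∧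
      (∀ i j, ContinuousOn (fun p : ℝ × (Fin n → ℝ) => pd i (pd j (v p.1)) p.2)
        (Ioc 0 T ×ˢ closure Ω)) ∧
      (∀ t ∈ Ioc (0:ℝ) T, ∀ x ∈ Ω,
        DifferentiableAt ℝ (v t) x ∧ ∀ j, DifferentiableAt ℝ (pd j (v t)) x))
    (heq : ∀ v ∈ ({u₁, u₂} : Set (ℝ → (Fin n → ℝ) → ℝ)), ∀ t ∈ Ioo (0:ℝ) T, ∀ x ∈ Ω,
      RLD β T (fun τ => v τ x - u₀ x) t = ellOp aC bC (v t) x + f (v t x) t x)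
    (hinit : ∀ v ∈ ({u₁, u₂} : Set (ℝ → (Fin n → ℝ) → ℝ)), ∀ x ∈ Ω, v 0 x = u₀ x)
    (hbc : ∀ v ∈ ({u₁, u₂} : Set (ℝ → (Fin n → ℝ) → ℝ)), ∀ t ∈ Ioo (0:ℝ) T,
      ∀ x ∈ frontier Ω, v t x = g t x)
    (hLip : ∃ M > (0:ℝ), ∀ t ∈ Icc (0:ℝ) T, ∀ x ∈ closure Ω,
      |f (u₁ t x) t x - f (u₂ t x) t x| ≤ M * |u₁ t x - u₂ t x|) :
    ∀ t ∈ Icc (0:ℝ) T, ∀ x ∈ closure Ω, u₁ t x = u₂ t x := by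
  obtain ⟨M, hM, hL⟩ := hLip
  obtain ⟨c₁, ⟨C₁, w₁⟩, -, -, d₁⟩ := hreg u₁ (by simp)
  obtain ⟨c₂, ⟨C₂, w₂⟩, -, -, d₂⟩ := hreg u₂ (by simp)
  have h1 := half_uniqueness T β β' hβ hβ' hβ'1 Ω hΩo hΩb aC bC hell f u₀ g u₁ u₂ C₁ C₂ M hT hM
    c₁ c₂ w₁ w₂ d₁ d₂ heq hinit hbc hL
  have h2 := half_uniqueness T β β' hβ hβ' hβ'1 Ω hΩo hΩb aC bC hell f u₀ g u₂ u₁ C₂ C₁ M hT hM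
    c₂ c₁ w₂ w₁ d₂ d₁ (by rwa [pair_comm]) (by rwa [pair_comm]) (by rwa [pair_comm])
    (fun t ht x hx => by
      rw [abs_sub_comm, abs_sub_comm (u₂ t x)]
      exact hL t ht x hx)
  intro t ht x hx
  linarith [h1 t ht x hx, h2 t ht x hx]
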